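/- arXiv:1309.1337 — 2 statements merged into one kernel-verified Lean document; each statement's English description precedes it below -/
import Mathlib

section
/- Any two elements a, b of an Artin monoid M(S) admit either a left least common multiple or no common left multiple at all: if there exists c ∈ M(S) and u, v ∈ M(S) with c = u · a = v · b, then there exists a left least common multiple of a and b, i.e. an element ℓ with ℓ = u' · a = v' · b for some u', v', such that every element d with d = x · a = y · b for some x, y satisfies d = e · ℓ for some e. -/
/-- The alternating word `sts…` with `m` letters. -/
def altWord {S : Type*} (s t : S) : ℕ → List S
  | 0 => []
  | n + 1 => s :: altWord t s n

theorem altWord_map {S T : Type*} (f : S → T) (s t : S) (k : ℕ) :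
    (altWord s t k).map f = altWord (f s) (f t) k := by
  induction k generalizing s t with
  | zero => rfl
  | succ n ih => simp [altWord, ih]

/-- A Coxeter matrix on `S`, with `⊤ : ℕ∞` meaning no relation. -/
structure CoxeterMat (S : Type*) where
  m : S → S → ℕ∞
  diag : ∀ s, m s s = 1
  symm : ∀ s t, m s t = m t s
  two_le : ∀ s t, s ≠ t → 2 ≤ m s t

variable {S : Type*}

/-- The braid relations of the Artin monoid presentation. -/
def artinRel (M : CoxeterMat S) : FreeMonoid S → FreeMonoid S → Prop := fun a b =>
  ∃ (s t : S) (k : ℕ), s ≠ t ∧ M.m s t = (k : ℕ∞) ∧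
    a = FreeMonoid.ofList (altWord s t k) ∧ b = FreeMonoid.ofList (altWord t s k)

/-- The Artin monoid of a Coxeter matrix. -/
abbrev ArtinMonoid (M : CoxeterMat S) : Type _ := PresentedMonoid (artinRel M)

/-- The canonical generators of the Artin monoid. -/
abbrev ArtinMonoid.of (M : CoxeterMat S) (s : S) : ArtinMonoid M :=
  PresentedMonoid.of (artinRel M) s

/-- Restriction of a Coxeter matrix to a subset. -/
def CoxeterMat.restrict (M : CoxeterMat S) (T : Set S) : CoxeterMat T where
  m s t := M.m s t
  diag s := M.diag s
  symm s t := M.symm s t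
  two_le s t h := M.two_le s t (fun hc => h (Subtype.ext hc))

theorem presentedMonoid_mk_ofList_map {α β : Type*} {rels : FreeMonoid β → FreeMonoid β → Prop}
    (φ : α → β) (l : List α) :
    FreeMonoid.lift (fun a => PresentedMonoid.of rels (φ a)) (FreeMonoid.ofList l)
      = PresentedMonoid.mk rels (FreeMonoid.ofList (l.map φ)) := by
  induction l with
  | nil => rfl
  | cons x l ih =>
      rw [show FreeMonoid.ofList (x :: l) = FreeMonoid.of x * FreeMonoid.ofList l from rfl,
        map_mul, ih]
      rfl

/-- The monoid homomorphism between Artin monoids induced by a map of generating sets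
compatible with the Coxeter matrices. -/
def ArtinMonoid.mapOf {A B : Type*} {MA : CoxeterMat A} {MB : CoxeterMat B} (φ : A → B)
    (hm : ∀ a a', MA.m a a' = MB.m (φ a) (φ a')) :
    ArtinMonoid MA →* ArtinMonoid MB := by
  refine PresentedMonoid.lift (fun a => PresentedMonoid.of (artinRel MB) (φ a)) ?_
  rintro a b ⟨s, t, k, hst, hk, rfl, rfl⟩
  have hne : φ s ≠ φ t := by
    intro hc
    have h1 : MB.m (φ s) (φ t) = 1 := by rw [hc, MB.diag]
    have h2 := MA.two_le s t hst
    rw [hm s t, h1] at h2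
    exact absurd h2 (by decide)
  rw [presentedMonoid_mk_ofList_map, presentedMonoid_mk_ofList_map,
    altWord_map, altWord_map]
  exact Quotient.sound (ConGen.Rel.of _ _ ⟨φ s, φ t, k, hne, by rw [← hm s t]; exact hk, rfl, rfl⟩)

/-- The canonical homomorphism `M(T) → M(T')` for `T ⊆ T'`. -/
def ArtinMonoid.incl (M : CoxeterMat S) {T T' : Set S} (h : T ⊆ T') :
    ArtinMonoid (M.restrict T) →* ArtinMonoid (M.restrict T') :=
  ArtinMonoid.mapOf (Set.inclusion h) (fun _ _ => rfl)

/-- The canonical homomorphism `M(T) → M(S)`. -/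
def ArtinMonoid.ι (M : CoxeterMat S) (T : Set S) :
    ArtinMonoid (M.restrict T) →* ArtinMonoid M :=
  ArtinMonoid.mapOf Subtype.val (fun _ _ => rfl)

/-- `ℓ` is a left least common multiple of `a` and `b`. -/
def IsLeftLcm {Mo : Type*} [Monoid Mo] (a b ℓ : Mo) : Prop :=
  (∃ u, ℓ = u * a) ∧ (∃ v, ℓ = v * b) ∧
    ∀ d : Mo, (∃ x, d = x * a) → (∃ y, d = y * b) → ∃ e, d = e * ℓ

/-- `E` is closed under left least common multiples and left complements. -/
def IsClosedUnderLcmAndCompl {Mo : Type*} [Monoid Mo] (E : Set Mo) : Prop :=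
  ∀ p q ℓ : Mo, p ∈ E → q ∈ E → IsLeftLcm p q ℓ →
    ℓ ∈ E ∪ {1} ∧ (∀ c, ℓ = c * q → c ∈ E ∪ {1}) ∧ (∀ c, ℓ = c * p → c ∈ E ∪ {1})

namespace CoxeterMatrix

variable {B : Type*} (M : CoxeterMatrix B)

/-- The cosine of the angle `π / M i j`, with the convention that it is `1` if there is no
relation between `i` and `j`. -/
noncomputable def cosAngle (i j : B) : ℝ :=
  if M i j = 0 then 1 else Real.cos (Real.pi / M i j)

theorem cosAngle_comm (i j : B) : M.cosAngle i j = M.cosAngle j i := by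
  unfold cosAngle
  rw [M.symmetric i j]

/-- The coordinates `sin (k π / M i j) / sin (π / M i j)` of the roots of a dihedral subsystem. -/
noncomputable def rootCoord (i j : B) (k : ℕ) : ℝ :=
  if M i j = 0 then k else Real.sin (k * (Real.pi / M i j)) / Real.sin (Real.pi / M i j)

theorem two_le_of_ne {i j : B} (hij : i ≠ j) (h0 : M i j ≠ 0) : 2 ≤ M i j := by
  have := M.off_diagonal i j hij
  omega

theorem sin_angle_pos {i j : B} (hij : i ≠ j) (h0 : M i j ≠ 0) :
    0 < Real.sin (Real.pi / M i j) := by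
  have h2 : (2 : ℝ) ≤ M i j := by exact_mod_cast M.two_le_of_ne hij h0
  refine Real.sin_pos_of_pos_of_lt_pi (div_pos Real.pi_pos (by linarith)) ?_
  exact div_lt_self Real.pi_pos (by linarith)

theorem rootCoord_zero (i j : B) : M.rootCoord i j 0 = 0 := by
  simp [rootCoord]

theorem rootCoord_one {i j : B} (hij : i ≠ j) : M.rootCoord i j 1 = 1 := by
  unfold rootCoord
  split_ifs with h
  · simp
  · simp [(M.sin_angle_pos hij h).ne']

theorem rootCoord_add_two (i j : B) (k : ℕ) :
    M.rootCoord i j (k + 2) = 2 * M.cosAngle i j * M.rootCoord i j (k + 1) - M.rootCoord i j k := by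
  unfold rootCoord cosAngle
  split_ifs with h
  · push_cast; ring
  · set θ := Real.pi / M i j
    have h1 : ((k + 2 : ℕ) : ℝ) * θ = ((k + 1 : ℕ) : ℝ) * θ + θ := by push_cast; ring
    have h2 : (k : ℝ) * θ = ((k + 1 : ℕ) : ℝ) * θ - θ := by push_cast; ring
    rw [h1, h2, Real.sin_add, Real.sin_sub]
    ring

theorem rootCoord_nonneg {i j : B} (hij : i ≠ j) {k : ℕ} (hk : M i j = 0 ∨ k ≤ M i j) :
    0 ≤ M.rootCoord i j k := by
  unfold rootCoord
  split_ifs with h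
  · positivity
  · have hpos : (0 : ℝ) < M i j := by exact_mod_cast Nat.pos_of_ne_zero h
    refine div_nonneg (Real.sin_nonneg_of_nonneg_of_le_pi (by positivity) ?_)
      (M.sin_angle_pos hij h).le
    have : (k : ℝ) ≤ M i j := by exact_mod_cast hk.resolve_left h
    rw [mul_div_assoc', div_le_iff₀ hpos, mul_comm]
    exact mul_le_mul_of_nonneg_left this Real.pi_pos.le

theorem rootCoord_two_mul {i j : B} (h0 : M i j ≠ 0) : M.rootCoord i j (2 * M i j) = 0 := by
  have : (M i j : ℝ) ≠ 0 := by exact_mod_cast h0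
  have h : ((2 * M i j : ℕ) : ℝ) * (Real.pi / M i j) = 2 * Real.pi := by
    push_cast; field_simp
  rw [rootCoord, if_neg h0, h, Real.sin_two_pi, zero_div]

theorem rootCoord_two_mul_add_one {i j : B} (hij : i ≠ j) (h0 : M i j ≠ 0) :
    M.rootCoord i j (2 * M i j + 1) = 1 := by
  have : (M i j : ℝ) ≠ 0 := by exact_mod_cast h0
  have h : ((2 * M i j + 1 : ℕ) : ℝ) * (Real.pi / M i j) = Real.pi / M i j + 2 * Real.pi := by
    push_cast; field_simp; ring
  rw [rootCoord, if_neg h0, h, Real.sin_add_two_pi, div_self (M.sin_angle_pos hij h0).ne']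

theorem cosAngle_sq_ne_one {i j : B} (hij : i ≠ j) (h0 : M i j ≠ 0) :
    1 - M.cosAngle i j ^ 2 ≠ 0 := by
  rw [cosAngle, if_neg h0, ← Real.sin_sq]
  exact pow_ne_zero _ (M.sin_angle_pos hij h0).ne'

theorem cosAngle_self (i : B) : M.cosAngle i i = -1 := by
  simp [cosAngle]

/-- The simple root `α i` of the geometric representation. -/
noncomputable def simpleRoot (i : B) : B →₀ ℝ := Finsupp.single i 1

/-- The simple coroot, as a linear functional on the geometric representation. -/
noncomputable def simpleCoroot (i : B) : (B →₀ ℝ) →ₗ[ℝ] ℝ :=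
  Finsupp.linearCombination ℝ fun j => -2 * M.cosAngle i j

theorem simpleCoroot_simpleRoot (i j : B) :
    M.simpleCoroot i (simpleRoot j) = -2 * M.cosAngle i j := by
  simp [simpleCoroot, simpleRoot]

/-- The simple reflection on the geometric representation. -/
noncomputable def geomReflection (i : B) : Module.End ℝ (B →₀ ℝ) :=
  LinearMap.id - (M.simpleCoroot i).smulRight (simpleRoot i)

theorem geomReflection_apply (i : B) (v : B →₀ ℝ) :
    M.geomReflection i v = v - M.simpleCoroot i v • simpleRoot i := by
  simp [geomReflection]

theorem geomReflection_simpleRoot_self (i : B) :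
    M.geomReflection i (simpleRoot i) = -simpleRoot i := by
  rw [geomReflection_apply, simpleCoroot_simpleRoot, cosAngle_self]
  module

theorem geomReflection_simpleRoot (i j : B) :
    M.geomReflection i (simpleRoot j) = simpleRoot j + (2 * M.cosAngle i j) • simpleRoot i := by
  rw [geomReflection_apply, simpleCoroot_simpleRoot]
  module

theorem geomReflection_mul_self (i : B) : M.geomReflection i * M.geomReflection i = 1 := by
  refine LinearMap.ext fun v => ?_
  rw [Module.End.mul_apply, geomReflection_apply M i v, map_sub, map_smul,
    geomReflection_simpleRoot_self, geomReflection_apply, Module.End.one_apply]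
  module

theorem prod_map_geomReflection_alternatingWord {i j : B} (hij : i ≠ j) (k : ℕ) :
    ((CoxeterSystem.alternatingWord i j k).map M.geomReflection).prod (simpleRoot i) =
      if Even k then M.rootCoord i j (k + 1) • simpleRoot i + M.rootCoord i j k • simpleRoot j
      else M.rootCoord i j k • simpleRoot i + M.rootCoord i j (k + 1) • simpleRoot j := by
  induction k with
  | zero => simp [CoxeterSystem.alternatingWord, rootCoord_zero, rootCoord_one M hij]
  | succ k ih =>
    rw [CoxeterSystem.alternatingWord_succ', List.map_cons, List.prod_cons, Module.End.mul_apply,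
      ih]
    rcases Nat.even_or_odd k with hk | hk
    · have hk' : ¬ Even (k + 1) := by simpa [Nat.even_add_one] using hk
      simp only [if_pos hk, if_neg hk', map_add, map_smul, geomReflection_simpleRoot_self,
        geomReflection_simpleRoot, rootCoord_add_two, M.cosAngle_comm j i]
      module
    · have hk' : Even (k + 1) := by simpa [Nat.even_add_one] using hk
      have hk'' : ¬ Even k := by simpa using hk
      simp only [if_neg hk'', if_pos hk', map_add, map_smul, geomReflection_simpleRoot_self,
        geomReflection_simpleRoot, rootCoord_add_two]
      module

theorem prod_map_alternatingWord_two_mul {G : Type*} [Monoid G] (f : B → G) (i j : B) (k : ℕ) :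
    ((CoxeterSystem.alternatingWord i j (2 * k)).map f).prod = (f i * f j) ^ k := by
  induction k with
  | zero => simp [CoxeterSystem.alternatingWord]
  | succ k ih =>
    rw [show 2 * (k + 1) = 2 * k + 1 + 1 by ring, CoxeterSystem.alternatingWord_succ',
      CoxeterSystem.alternatingWord_succ']
    simp [ih, pow_succ', mul_assoc]

theorem geomReflection_mul_pow_simpleRoot_left {i j : B} (hij : i ≠ j) (h0 : M i j ≠ 0) :
    ((M.geomReflection i * M.geomReflection j) ^ M i j) (simpleRoot i) = simpleRoot i := by
  rw [← prod_map_alternatingWord_two_mul, prod_map_geomReflection_alternatingWord M hij,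
    if_pos (even_two_mul _), rootCoord_two_mul M h0, rootCoord_two_mul_add_one M hij h0]
  simp

theorem geomReflection_isLiftable : M.IsLiftable M.geomReflection := by
  intro i j
  by_cases hij : i = j
  · subst hij
    simp [geomReflection_mul_self]
  by_cases h0 : M i j = 0
  · simp [h0]
  have hi := M.geomReflection_mul_pow_simpleRoot_left hij h0
  have hj : ((M.geomReflection i * M.geomReflection j) ^ M i j) (simpleRoot j) = simpleRoot j := by
    have h := M.geomReflection_mul_pow_simpleRoot_left (Ne.symm hij)
      (by rwa [M.symmetric j i])
    rw [M.symmetric j i] at h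
    have hinv : (M.geomReflection i * M.geomReflection j) *
        (M.geomReflection j * M.geomReflection i) = 1 := by
      rw [mul_assoc, ← mul_assoc (M.geomReflection j), geomReflection_mul_self, one_mul,
        geomReflection_mul_self]
    have := congrArg (fun T : Module.End ℝ (B →₀ ℝ) => T (simpleRoot j))
      (pow_mul_pow_eq_one (M i j) hinv)
    simpa [Module.End.mul_apply, h] using this
  have hc := M.cosAngle_sq_ne_one hij h0
  refine LinearMap.ext fun z => ?_
  set c := M.cosAngle i j with hcdef
  set x := (M.simpleCoroot i z + c * M.simpleCoroot j z) / (2 * (1 - c ^ 2)) with hx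
  set y := (c * M.simpleCoroot i z + M.simpleCoroot j z) / (2 * (1 - c ^ 2)) with hy
  set z' := z - x • simpleRoot i - y • simpleRoot j with hz'
  have hfi : M.simpleCoroot i z' = 0 := by
    simp only [hz', map_sub, map_smul, simpleCoroot_simpleRoot, cosAngle_self, smul_eq_mul,
      ← hcdef, hx, hy]
    field_simp
    ring
  have hfj : M.simpleCoroot j z' = 0 := by
    simp only [hz', map_sub, map_smul, simpleCoroot_simpleRoot, cosAngle_self, smul_eq_mul,
      M.cosAngle_comm j i, ← hcdef, hx, hy]
    field_simp
    ring
  have hT : (M.geomReflection i * M.geomReflection j) z' = z' := by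
    rw [Module.End.mul_apply, geomReflection_apply M j, hfj, zero_smul, sub_zero,
      geomReflection_apply, hfi, zero_smul, sub_zero]
  have hTk : ∀ k : ℕ, ((M.geomReflection i * M.geomReflection j) ^ k) z' = z' := by
    intro k
    induction k with
    | zero => rfl
    | succ k ih => rw [pow_succ, Module.End.mul_apply, hT, ih]
  have hz : z = z' + x • simpleRoot i + y • simpleRoot j := by
    rw [hz']; abel
  rw [hz, map_add, map_add, map_smul, map_smul, hTk, hi, hj, Module.End.one_apply]

end CoxeterMatrix

namespace CoxeterSystem

variable {B W : Type*} [Group W] {M : CoxeterMatrix B} (cs : CoxeterSystem M W)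

/-! ### The geometric representation and dihedral cosets -/

/-- The geometric representation of a Coxeter system. -/
noncomputable def geomRep : W →* Module.End ℝ (B →₀ ℝ) :=
  cs.lift ⟨M.geomReflection, M.geomReflection_isLiftable⟩

theorem geomRep_simple (i : B) : cs.geomRep (cs.simple i) = M.geomReflection i :=
  cs.lift_apply_simple M.geomReflection_isLiftable i

theorem geomRep_wordProd (l : List B) :
    cs.geomRep (cs.wordProd l) = (l.map M.geomReflection).prod := by
  induction l with
  | nil => simp
  | cons i l ih => rw [wordProd_cons, map_mul, ih, geomRep_simple, List.map_cons, List.prod_cons]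

theorem exists_alternatingWord_add (i j : B) (m n : ℕ) :
    ∃ l : List B, l.length = n ∧ alternatingWord i j (n + m) = l ++ alternatingWord i j m := by
  induction n with
  | zero => exact ⟨[], rfl, by simp⟩
  | succ n ih =>
    obtain ⟨l, hl, h⟩ := ih
    rw [show n + 1 + m = n + m + 1 by ring, alternatingWord_succ', h]
    exact ⟨_ :: l, by simp [hl], rfl⟩

theorem reverse_alternatingWord (i j : B) (k : ℕ) :
    (alternatingWord i j k).reverse =
      if Even k then alternatingWord j i k else alternatingWord i j k := by
  induction k generalizing i j with
  | zero => simp [alternatingWord]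
  | succ k ih =>
    conv_lhs => rw [alternatingWord_succ, List.concat_eq_append, List.reverse_append, ih j i]
    rcases Nat.even_or_odd k with hk | hk
    · have hk' : ¬ Even (k + 1) := by simpa [Nat.even_add_one] using hk
      rw [if_pos hk, if_neg hk', alternatingWord_succ', if_pos hk]
      rfl
    · have hk' : Even (k + 1) := by simpa [Nat.even_add_one] using hk
      have hk'' : ¬ Even k := by simpa using hk
      rw [if_neg hk'', if_pos hk', alternatingWord_succ', if_neg hk'']
      rfl

theorem wordProd_alternatingWord_succ (i j : B) (k : ℕ) :
    cs.wordProd (alternatingWord i j (k + 1)) =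
      cs.wordProd (alternatingWord j i k) * cs.simple j := by
  rw [alternatingWord_succ, wordProd_concat]

theorem exists_eq_mul_alternatingWord (w : W) (i j : B) (hi : ¬ cs.IsRightDescent w i) :
    ∃ (k : ℕ) (w' : W), w = w' * cs.wordProd (alternatingWord i j k) ∧
      cs.length w = cs.length w' + k ∧
      ¬ cs.IsRightDescent w' i ∧ ¬ cs.IsRightDescent w' j := by
  induction hn : cs.length w using Nat.strong_induction_on generalizing w i j with
  | _ n ih =>
    by_cases hj : cs.IsRightDescent w j
    · have hlen := cs.isRightDescent_iff.mp hj
      obtain ⟨k, w', h1, h2, h3, h4⟩ := ih _ (by omega) (w * cs.simple j) j i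
        (cs.isRightDescent_iff_not_isRightDescent_mul.mp hj) rfl
      refine ⟨k + 1, w', ?_, by omega, h4, h3⟩
      rw [wordProd_alternatingWord_succ, ← mul_assoc, ← h1, simple_mul_simple_cancel_right]
    · exact ⟨0, w, by simp [alternatingWord], by simp [hn], hi, hj⟩

theorem exists_eq_mul_alternatingWord_of_le {w w' : W} {i j : B} {k m : ℕ} (hm : m ≤ k)
    (h : w = w' * cs.wordProd (alternatingWord i j k)) (hl : cs.length w = cs.length w' + k) :
    ∃ x, w = x * cs.wordProd (alternatingWord i j m) ∧ cs.length w = cs.length x + m := by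
  obtain ⟨n, rfl⟩ := Nat.exists_eq_add_of_le' hm
  obtain ⟨l, hl', hw⟩ := exists_alternatingWord_add i j m n
  refine ⟨w' * cs.wordProd l, by rw [h, hw, wordProd_append, mul_assoc], le_antisymm ?_ ?_⟩
  · calc cs.length w = cs.length (w' * cs.wordProd l * cs.wordProd (alternatingWord i j m)) := by
          rw [h, hw, wordProd_append, mul_assoc]
      _ ≤ _ := cs.length_mul_le _ _
      _ ≤ _ := by
        have := cs.length_wordProd_le (alternatingWord i j m)
        rw [length_alternatingWord] at this
        omega
  · have h1 := cs.length_mul_le w' (cs.wordProd l)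
    have h2 := cs.length_wordProd_le l
    omega

theorem wordProd_braidWord_mul_simple {i j : B} (h0 : M i j ≠ 0) :
    cs.length (cs.wordProd (alternatingWord i j (M i j)) * cs.simple i) + 1 ≤ M i j := by
  obtain ⟨m, hm⟩ := Nat.exists_eq_succ_of_ne_zero h0
  have h := cs.wordProd_braidWord_eq i j
  rw [braidWord, braidWord, M.symmetric j i] at h
  rw [h, hm, Nat.succ_eq_add_one, wordProd_alternatingWord_succ, simple_mul_simple_cancel_right]
  have := cs.length_wordProd_le (alternatingWord i j m)
  rw [length_alternatingWord] at this
  omega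

theorem lt_of_not_isRightDescent {w w' : W} {i j : B} {k : ℕ} (h0 : M i j ≠ 0)
    (hi : ¬ cs.IsRightDescent w i) (h : w = w' * cs.wordProd (alternatingWord i j k))
    (hl : cs.length w = cs.length w' + k) : k < M i j := by
  by_contra! hk
  obtain ⟨x, hx, hlx⟩ := cs.exists_eq_mul_alternatingWord_of_le hk h hl
  apply hi
  unfold IsRightDescent
  have h1 := cs.wordProd_braidWord_mul_simple h0
  have h2 := cs.length_mul_le x (cs.wordProd (alternatingWord i j (M i j)) * cs.simple i)
  rw [← mul_assoc, ← hx] at h2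
  omega

theorem geomRep_mul_alternatingWord_nonneg {w : W} {i j : B} (hij : i ≠ j) {k : ℕ}
    (hk : M i j = 0 ∨ k < M i j)
    (hi : 0 ≤ cs.geomRep w (CoxeterMatrix.simpleRoot i))
    (hj : 0 ≤ cs.geomRep w (CoxeterMatrix.simpleRoot j)) :
    0 ≤ cs.geomRep (w * cs.wordProd (alternatingWord i j k)) (CoxeterMatrix.simpleRoot i) := by
  have h1 : 0 ≤ M.rootCoord i j k := M.rootCoord_nonneg hij (hk.imp_right fun h => h.le)
  have h2 : 0 ≤ M.rootCoord i j (k + 1) := M.rootCoord_nonneg hij hk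
  rw [map_mul, Module.End.mul_apply, geomRep_wordProd,
    M.prod_map_geomReflection_alternatingWord hij]
  split_ifs
  · rw [map_add, map_smul, map_smul]
    exact add_nonneg (smul_nonneg h2 hi) (smul_nonneg h1 hj)
  · rw [map_add, map_smul, map_smul]
    exact add_nonneg (smul_nonneg h1 hi) (smul_nonneg h2 hj)

theorem geomRep_simpleRoot_nonneg {w : W} {i : B} (hi : ¬ cs.IsRightDescent w i) :
    0 ≤ cs.geomRep w (CoxeterMatrix.simpleRoot i) := by
  induction hn : cs.length w using Nat.strong_induction_on generalizing w i with
  | _ n ih =>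
    by_cases hw : w = 1
    · rw [hw, map_one, Module.End.one_apply, CoxeterMatrix.simpleRoot, Finsupp.single_nonneg]
      exact zero_le_one
    obtain ⟨j, hj⟩ := cs.exists_rightDescent_of_ne_one hw
    have hij : i ≠ j := by rintro rfl; exact hi hj
    obtain ⟨k, w', h1, h2, h3, h4⟩ := cs.exists_eq_mul_alternatingWord w i j hi
    have hk : k ≠ 0 := by
      rintro rfl
      simp only [alternatingWord, wordProd_nil, mul_one] at h1
      exact h4 (h1 ▸ hj)
    rw [h1]
    refine cs.geomRep_mul_alternatingWord_nonneg hij ?_ (ih _ (by omega) h3 rfl)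
      (ih _ (by omega) h4 rfl)
    by_cases h0 : M i j = 0
    · exact Or.inl h0
    · exact Or.inr (cs.lt_of_not_isRightDescent h0 hi h1 h2)

theorem not_isRightDescent_of_geomRep_nonneg {w : W} {i : B}
    (h : 0 ≤ cs.geomRep w (CoxeterMatrix.simpleRoot i)) : ¬ cs.IsRightDescent w i := by
  intro hi
  have h1 := cs.geomRep_simpleRoot_nonneg (cs.isRightDescent_iff_not_isRightDescent_mul.mp hi)
  rw [map_mul, Module.End.mul_apply, geomRep_simple, M.geomReflection_simpleRoot_self,
    map_neg] at h1
  have h2 : cs.geomRep w (CoxeterMatrix.simpleRoot i) = 0 :=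
    le_antisymm (neg_nonneg.mp h1) h
  have h3 := congrArg (cs.geomRep w⁻¹) h2
  rw [← Module.End.mul_apply, ← map_mul, inv_mul_cancel, map_one, map_zero,
    Module.End.one_apply] at h3
  exact one_ne_zero (Finsupp.single_eq_zero.mp h3)

theorem length_mul_alternatingWord {w : W} {i j : B} (hij : i ≠ j)
    (hi : ¬ cs.IsRightDescent w i) (hj : ¬ cs.IsRightDescent w j) {k : ℕ}
    (hk : M i j = 0 ∨ k ≤ M i j) :
    cs.length (w * cs.wordProd (alternatingWord i j k)) = cs.length w + k := by
  induction k generalizing i j with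
  | zero => simp [alternatingWord]
  | succ k ih =>
    rw [M.symmetric i j] at hk
    rw [wordProd_alternatingWord_succ, ← mul_assoc, cs.not_isRightDescent_iff.mp,
      ih hij.symm hj hi (hk.imp_right Nat.le_of_succ_le), add_assoc]
    exact cs.not_isRightDescent_of_geomRep_nonneg
      (cs.geomRep_mul_alternatingWord_nonneg hij.symm hk
        (cs.geomRep_simpleRoot_nonneg hj) (cs.geomRep_simpleRoot_nonneg hi))

theorem isReduced_alternatingWord {i j : B} (hij : i ≠ j) {k : ℕ}
    (hk : M i j = 0 ∨ k ≤ M i j) : cs.IsReduced (alternatingWord i j k) := by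
  have := cs.length_mul_alternatingWord hij (cs.not_isRightDescent_one i)
    (cs.not_isRightDescent_one j) hk
  simpa [IsReduced] using this

theorem exists_eq_mul_braidWord {w : W} {i j : B} (hij : i ≠ j)
    (hi : cs.IsRightDescent w i) (hj : cs.IsRightDescent w j) :
    M i j ≠ 0 ∧ ∃ x, w = x * cs.wordProd (alternatingWord i j (M i j)) ∧
      cs.length w = cs.length x + M i j := by
  obtain ⟨k, w', h1, h2, h3, h4⟩ := cs.exists_eq_mul_alternatingWord (w * cs.simple j) j i
    (cs.isRightDescent_iff_not_isRightDescent_mul.mp hj)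
  have hlen := cs.isRightDescent_iff.mp hj
  have hw : w = w' * cs.wordProd (alternatingWord i j (k + 1)) := by
    rw [wordProd_alternatingWord_succ, ← mul_assoc, ← h1, simple_mul_simple_cancel_right]
  by_cases hk : M i j = 0 ∨ k + 1 < M i j
  · have := cs.geomRep_mul_alternatingWord_nonneg hij hk
      (cs.geomRep_simpleRoot_nonneg h4) (cs.geomRep_simpleRoot_nonneg h3)
    rw [← hw] at this
    exact absurd hi (cs.not_isRightDescent_of_geomRep_nonneg this)
  · push Not at hk
    exact ⟨hk.1, cs.exists_eq_mul_alternatingWord_of_le hk.2 hw (by omega)⟩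

theorem length_braidWord_mul {w : W} {i j : B} (hij : i ≠ j)
    (hi : ¬ cs.IsLeftDescent w i) (hj : ¬ cs.IsLeftDescent w j) :
    cs.length (cs.wordProd (alternatingWord i j (M i j)) * w) = M i j + cs.length w := by
  have h : (cs.wordProd (alternatingWord i j (M i j)))⁻¹ =
      cs.wordProd (alternatingWord i j (M i j)) := by
    rw [← wordProd_reverse, reverse_alternatingWord]
    split_ifs
    · have h := cs.wordProd_braidWord_eq i j
      rw [braidWord, braidWord, M.symmetric j i] at h
      exact h.symm
    · rfl
  rw [← cs.isRightDescent_inv_iff] at hi hj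
  have := cs.length_mul_alternatingWord hij hi hj (Or.inr le_rfl)
  rw [← length_inv, mul_inv_rev, h, this, length_inv, add_comm]

/-! ### Suffixes in the weak order -/

/-- `v` is a suffix of `w`: there is a reduced expression of `w` ending with one of `v`. -/
def IsSuffix (v w : W) : Prop := cs.length (w * v⁻¹) + cs.length v = cs.length w

variable {cs}

theorem isSuffix_of_le {v w : W} (h : cs.length (w * v⁻¹) + cs.length v ≤ cs.length w) :
    cs.IsSuffix v w := by
  refine le_antisymm h ?_
  simpa using cs.length_mul_le (w * v⁻¹) v

theorem isSuffix_refl (w : W) : cs.IsSuffix w w := by simp [IsSuffix]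

theorem isSuffix_mul {u v : W} (h : cs.length (u * v) = cs.length u + cs.length v) :
    cs.IsSuffix v (u * v) := by
  rw [IsSuffix, mul_inv_cancel_right, h]

theorem IsSuffix.length_le {v w : W} (h : cs.IsSuffix v w) : cs.length v ≤ cs.length w := by
  unfold IsSuffix at h
  omega

theorem IsSuffix.trans {u v w : W} (h1 : cs.IsSuffix u v) (h2 : cs.IsSuffix v w) :
    cs.IsSuffix u w := by
  apply isSuffix_of_le
  have := cs.length_mul_le (w * v⁻¹) (v * u⁻¹)
  rw [← mul_assoc, inv_mul_cancel_right] at this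
  unfold IsSuffix at h1 h2
  omega

theorem IsSuffix.length_eq_add {u v w : W} (h1 : cs.IsSuffix u v) (h2 : cs.IsSuffix v w) :
    cs.length (w * u⁻¹) = cs.length (w * v⁻¹) + cs.length (v * u⁻¹) := by
  have h3 := h1.trans h2
  unfold IsSuffix at h1 h2 h3
  omega

theorem IsSuffix.eq_of_length_le {v w : W} (h : cs.IsSuffix v w)
    (hl : cs.length w ≤ cs.length v) : v = w := by
  unfold IsSuffix at h
  have : cs.length (w * v⁻¹) = 0 := by omega
  rw [length_eq_zero_iff, mul_inv_eq_one] at this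
  exact this.symm

theorem IsSuffix.antisymm {v w : W} (h1 : cs.IsSuffix v w) (h2 : cs.IsSuffix w v) : v = w :=
  h1.eq_of_length_le h2.length_le

theorem IsSuffix.not_isRightDescent {v w : W} {i : B} (h : cs.IsSuffix v w)
    (hw : ¬ cs.IsRightDescent w i) : ¬ cs.IsRightDescent v i := by
  have h1 := cs.not_isRightDescent_iff.mp hw
  have h2 := cs.length_mul_le (w * v⁻¹) (v * cs.simple i)
  rw [← mul_assoc, inv_mul_cancel_right] at h2
  unfold IsSuffix at h
  unfold IsRightDescent
  omega

theorem isSuffix_simple_mul {v : W} {i : B} (h : ¬ cs.IsLeftDescent v i) :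
    cs.IsSuffix v (cs.simple i * v) := by
  apply isSuffix_mul
  rw [cs.not_isLeftDescent_iff.mp h, length_simple, add_comm]

theorem IsSuffix.exists_simple_mul {v w : W} (h : cs.IsSuffix v w) (hne : v ≠ w) :
    ∃ i, ¬ cs.IsLeftDescent v i ∧ cs.IsSuffix (cs.simple i * v) w := by
  obtain ⟨i, hi⟩ := cs.exists_rightDescent_of_ne_one (w := w * v⁻¹)
    (fun hc => hne (mul_inv_eq_one.mp hc).symm)
  have h1 := cs.isRightDescent_iff.mp hi
  have h2 := cs.length_simple_mul v i
  have hS : cs.IsSuffix (cs.simple i * v) w := by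
    apply isSuffix_of_le
    rw [mul_inv_rev, inv_simple, ← mul_assoc]
    unfold IsSuffix at h
    omega
  refine ⟨i, ?_, hS⟩
  unfold IsSuffix at h hS
  rw [mul_inv_rev, inv_simple, ← mul_assoc] at hS
  rw [cs.not_isLeftDescent_iff]
  omega

theorem IsSuffix.isRightDescent_mul_inv {v w : W} {i : B} (hv : ¬ cs.IsLeftDescent v i)
    (h : cs.IsSuffix (cs.simple i * v) w) : cs.IsRightDescent (w * v⁻¹) i := by
  have h1 := (isSuffix_simple_mul hv).trans h
  have h2 := cs.not_isLeftDescent_iff.mp hv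
  unfold IsSuffix at h h1
  rw [mul_inv_rev, inv_simple, ← mul_assoc] at h
  unfold IsRightDescent
  omega

theorem isSuffix_simple_mul_braidWord_mul {v : W} {i j : B} (hij : i ≠ j) (h0 : M i j ≠ 0)
    (hi : ¬ cs.IsLeftDescent v i) (hj : ¬ cs.IsLeftDescent v j) :
    cs.IsSuffix (cs.simple i * v) (cs.wordProd (alternatingWord i j (M i j)) * v) := by
  apply isSuffix_of_le
  rw [cs.length_braidWord_mul hij hi hj, cs.not_isLeftDescent_iff.mp hi, mul_inv_rev,
    inv_simple, ← mul_assoc, mul_inv_cancel_right]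
  have := cs.wordProd_braidWord_mul_simple h0
  omega

theorem IsSuffix.braidWord_mul {v w : W} {i j : B} (hij : i ≠ j)
    (hi : ¬ cs.IsLeftDescent v i) (hj : ¬ cs.IsLeftDescent v j)
    (hiw : cs.IsSuffix (cs.simple i * v) w) (hjw : cs.IsSuffix (cs.simple j * v) w) :
    M i j ≠ 0 ∧ cs.IsSuffix (cs.wordProd (alternatingWord i j (M i j)) * v) w := by
  obtain ⟨h0, x, hx, hl⟩ := cs.exists_eq_mul_braidWord hij
    (hiw.isRightDescent_mul_inv hi) (hjw.isRightDescent_mul_inv hj)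
  refine ⟨h0, isSuffix_of_le ?_⟩
  rw [cs.length_braidWord_mul hij hi hj, mul_inv_rev, ← mul_assoc, hx, mul_inv_cancel_right]
  have := (isSuffix_simple_mul hi).trans hiw
  unfold IsSuffix at this
  omega

theorem not_isRightDescent_braidWord_mul {v : W} {i j r : B} (hij : i ≠ j)
    (hi : ¬ cs.IsLeftDescent v i) (hj : ¬ cs.IsLeftDescent v j) (hv : ¬ cs.IsRightDescent v r)
    (hir : ¬ cs.IsRightDescent (cs.simple i * v) r)
    (hjr : ¬ cs.IsRightDescent (cs.simple j * v) r) :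
    ¬ cs.IsRightDescent (cs.wordProd (alternatingWord i j (M i j)) * v) r := by
  have key : ∀ a, ¬ cs.IsLeftDescent v a → ¬ cs.IsRightDescent (cs.simple a * v) r →
      ¬ cs.IsLeftDescent (v * cs.simple r) a := by
    intro a ha har
    rw [not_isLeftDescent_iff] at ha ⊢
    rw [not_isRightDescent_iff] at har hv
    rw [← mul_assoc]
    omega
  rw [not_isRightDescent_iff, mul_assoc, cs.length_braidWord_mul hij (key i hi hir)
    (key j hj hjr), cs.length_braidWord_mul hij hi hj, cs.not_isRightDescent_iff.mp hv,
    add_assoc]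

variable (cs)

/-- `v` is the largest suffix of `w` whose product with `g` is length-additive. -/
def IsMaxSuffix (g w v : W) : Prop :=
  cs.IsSuffix v w ∧ cs.length (v * g) = cs.length v + cs.length g ∧
    ∀ v', cs.IsSuffix v' w → cs.length (v' * g) = cs.length v' + cs.length g → cs.IsSuffix v' v

variable {cs}

theorem IsMaxSuffix.unique {g w v v' : W} (h : cs.IsMaxSuffix g w v)
    (h' : cs.IsMaxSuffix g w v') : v = v' :=
  (h'.2.2 v h.1 h.2.1).antisymm (h.2.2 v' h'.1 h'.2.1)

variable (cs)

theorem exists_greatest_suffix_above (w : W) (r : B) {v : W} (hv : cs.IsSuffix v w)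
    (hr : ¬ cs.IsRightDescent v r) :
    ∃ g, cs.IsSuffix g w ∧ ¬ cs.IsRightDescent g r ∧ cs.IsSuffix v g ∧
      ∀ v', cs.IsSuffix v' w → ¬ cs.IsRightDescent v' r → cs.IsSuffix v v' →
        cs.IsSuffix v' g := by
  induction hn : cs.length w - cs.length v using Nat.strong_induction_on generalizing v with
  | _ n ih =>
    have hrec : ∀ i, ¬ cs.IsLeftDescent v i → cs.IsSuffix (cs.simple i * v) w →
        ¬ cs.IsRightDescent (cs.simple i * v) r → ∃ g, cs.IsSuffix g w ∧
          ¬ cs.IsRightDescent g r ∧ cs.IsSuffix (cs.simple i * v) g ∧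
          ∀ v', cs.IsSuffix v' w → ¬ cs.IsRightDescent v' r →
            cs.IsSuffix (cs.simple i * v) v' → cs.IsSuffix v' g := by
      intro i hi hiw hir
      refine ih _ ?_ hiw hir rfl
      have h1 := cs.not_isLeftDescent_iff.mp hi
      have h2 := hiw.length_le
      omega
    by_cases hs : ∃ i, ¬ cs.IsLeftDescent v i ∧ cs.IsSuffix (cs.simple i * v) w ∧
        ¬ cs.IsRightDescent (cs.simple i * v) r
    · obtain ⟨i, hi, hiw, hir⟩ := hs
      obtain ⟨g, hgw, hgr, hig, hg⟩ := hrec i hi hiw hir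
      refine ⟨g, hgw, hgr, (isSuffix_simple_mul hi).trans hig, fun v' hvw hvr hvv => ?_⟩
      by_cases hne : v = v'
      · rw [← hne]
        exact (isSuffix_simple_mul hi).trans hig
      obtain ⟨j, hj, hjv⟩ := hvv.exists_simple_mul hne
      by_cases hij : i = j
      · subst hij
        exact hg v' hvw hvr hjv
      have hjw := hjv.trans hvw
      have hjr := hjv.not_isRightDescent hvr
      obtain ⟨g', hgw', hgr', hjg', hg'⟩ := hrec j hj hjw hjr
      obtain ⟨h0, hD⟩ := IsSuffix.braidWord_mul hij hi hj hiw hjw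
      have hDr := not_isRightDescent_braidWord_mul hij hi hj hr hir hjr
      have hDi := isSuffix_simple_mul_braidWord_mul hij h0 hi hj
      have hDj := isSuffix_simple_mul_braidWord_mul (Ne.symm hij)
        (by rwa [M.symmetric j i]) hj hi
      have hsymm := cs.wordProd_braidWord_eq i j
      rw [braidWord, braidWord] at hsymm
      rw [← hsymm] at hDj
      exact (hg' v' hvw hvr hjv).trans
        (hg g' hgw' hgr' (hDi.trans (hg' _ hD hDr hDj)))
    · refine ⟨v, hv, hr, isSuffix_refl v, fun v' hvw hvr hvv => ?_⟩
      by_cases hne : v = v'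
      · rw [hne]
        exact isSuffix_refl _
      obtain ⟨j, hj, hjv⟩ := hvv.exists_simple_mul hne
      exact absurd ⟨j, hj, hjv.trans hvw, hjv.not_isRightDescent hvr⟩ hs

theorem exists_isMaxSuffix_simple (r : B) (w : W) : ∃ v, cs.IsMaxSuffix (cs.simple r) w v := by
  have h1 : cs.IsSuffix 1 w := by simp [IsSuffix]
  obtain ⟨g, hgw, hgr, -, hg⟩ :=
    cs.exists_greatest_suffix_above w r h1 (cs.not_isRightDescent_one r)
  refine ⟨g, hgw, by rw [length_simple, cs.not_isRightDescent_iff.mp hgr], fun v' hv hr => ?_⟩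
  refine hg v' hv ?_ (by simp [IsSuffix])
  rwa [not_isRightDescent_iff, ← cs.length_simple r]

variable {cs}

theorem IsMaxSuffix.mul_simple {g w v u : W} {r : B}
    (hg : cs.length (g * cs.simple r) = cs.length g + 1)
    (hv : cs.IsMaxSuffix g w v) (hu : cs.IsMaxSuffix (cs.simple r) (v * g) u) :
    cs.IsMaxSuffix (g * cs.simple r) w (u * g⁻¹) ∧ cs.IsSuffix (u * g⁻¹) v := by
  obtain ⟨hvw, hvg, hvm⟩ := hv
  obtain ⟨huv, hur, hum⟩ := hu
  rw [length_simple] at hur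
  have hgu : cs.IsSuffix g u := hum g (isSuffix_mul hvg) (by rw [length_simple, hg])
  have huv' : cs.IsSuffix (u * g⁻¹) v := by
    apply isSuffix_of_le
    unfold IsSuffix at huv hgu
    rw [mul_inv_rev, inv_inv, ← mul_assoc]
    omega
  refine ⟨⟨huv'.trans hvw, ?_, fun x hx hxg => ?_⟩, huv'⟩
  · unfold IsSuffix at hgu
    rw [← mul_assoc, inv_mul_cancel_right, hur, hg]
    omega
  · rw [← mul_assoc, hg] at hxg
    have h1 : cs.length (x * g) = cs.length x + cs.length g := by
      have h2 := cs.length_mul_le (x * g) (cs.simple r)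
      have h3 := cs.length_mul_le x g
      rw [length_simple] at h2
      omega
    have hxv := hvm x hx h1
    have hxu := hum (x * g) (isSuffix_of_le ?_) (by rw [hxg, h1, length_simple, add_assoc])
    · apply isSuffix_of_le
      unfold IsSuffix at hxu hgu
      rw [mul_inv_rev, ← mul_assoc] at hxu
      omega
    · unfold IsSuffix at hxv
      rw [mul_inv_rev, ← mul_assoc, mul_inv_cancel_right]
      omega

variable (cs)

/-! ### Matsumoto's theorem and the normal form action -/

section Lift

variable {N : Type*} [Monoid N]

/-- A map from the index set of a Coxeter matrix to a monoid whose values satisfy the braid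
relations. -/
def RespectsBraids (M : CoxeterMatrix B) (f : B → N) : Prop :=
  ∀ i j, i ≠ j → M i j ≠ 0 →
    ((braidWord M i j).map f).prod = ((braidWord M j i).map f).prod

/-- Matsumoto's theorem: a map to a monoid that respects the braid relations takes the same value
on all reduced expressions of an element. -/
theorem prod_map_eq_of_isReduced {f : B → N}
    (hf : RespectsBraids M f)
    {l l' : List B} (hl : cs.IsReduced l) (hl' : cs.IsReduced l')
    (h : cs.wordProd l = cs.wordProd l') : (l.map f).prod = (l'.map f).prod := by
  induction hn : l.length using Nat.strong_induction_on generalizing l l' with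
  | _ n ih =>
    have hlen : l.length = l'.length := by rw [← hl.eq, h, hl'.eq]
    rcases List.eq_nil_or_concat l with rfl | ⟨l₁, i, rfl⟩
    · rw [List.eq_nil_of_length_eq_zero hlen.symm]
    rcases List.eq_nil_or_concat l' with rfl | ⟨l₂, j, rfl⟩
    · simp at hlen
    have cancel : ∀ {a b : List B} {k : B}, (a ++ [k]).length = n → cs.IsReduced (a ++ [k]) →
        cs.IsReduced (b ++ [k]) → cs.wordProd (a ++ [k]) = cs.wordProd (b ++ [k]) →
        ((a ++ [k]).map f).prod = ((b ++ [k]).map f).prod := by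
      intro a b k hk ha hb hab
      have ha' : cs.IsReduced a := by simpa using ha.take a.length
      have hb' : cs.IsReduced b := by simpa using hb.take b.length
      rw [wordProd_append, wordProd_append] at hab
      have := ih a.length (by simp at hk; omega) ha' hb' (mul_right_cancel hab) rfl
      simp [this]
    have desc : ∀ {a : List B} {k : B}, cs.IsReduced (a ++ [k]) →
        cs.IsRightDescent (cs.wordProd (a ++ [k])) k := by
      intro a k ha
      unfold IsRightDescent
      rw [ha.eq, wordProd_append, wordProd_singleton, simple_mul_simple_cancel_right]
      have := cs.length_wordProd_le a
      simp
      omega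
    simp only [List.concat_eq_append] at *
    by_cases hij : i = j
    · subst hij
      exact cancel hn hl hl' h
    obtain ⟨h0, x, hx, hxl⟩ := cs.exists_eq_mul_braidWord hij (desc hl)
      (h ▸ desc hl' : cs.IsRightDescent (cs.wordProd (l₁ ++ [i])) j)
    obtain ⟨c, hc, rfl⟩ := cs.exists_isReduced x
    obtain ⟨m, hm⟩ := Nat.exists_eq_succ_of_ne_zero h0
    have hbraid := cs.wordProd_braidWord_eq i j
    have hfb := hf i j hij h0
    rw [braidWord, braidWord, M.symmetric j i, hm, Nat.succ_eq_add_one] at hbraid hfb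
    rw [hm, Nat.succ_eq_add_one] at hx hxl
    rw [hc.eq, hl.eq] at hxl
    have hw : ∀ a b : B, (c ++ alternatingWord a b (m + 1)) =
        (c ++ alternatingWord b a m) ++ [b] := by
      intro a b
      rw [alternatingWord_succ, List.concat_eq_append, List.append_assoc]
    have hj : cs.wordProd (l₁ ++ [i]) = cs.wordProd (c ++ alternatingWord i j (m + 1)) := by
      rw [hx, wordProd_append]
    have hi : cs.wordProd (l₁ ++ [i]) = cs.wordProd (c ++ alternatingWord j i (m + 1)) := by
      rw [hx, hbraid, wordProd_append]
    have hjr : cs.IsReduced (c ++ alternatingWord i j (m + 1)) := by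
      rw [IsReduced, ← hj, hl.eq]
      simp only [List.length_append, length_alternatingWord] at hxl ⊢
      omega
    have hir : cs.IsReduced (c ++ alternatingWord j i (m + 1)) := by
      rw [IsReduced, ← hi, hl.eq]
      simp only [List.length_append, length_alternatingWord] at hxl ⊢
      omega
    have e1 := cancel hn hl (hw j i ▸ hir) (hw j i ▸ hi)
    have e2 := cancel (hlen.symm.trans hn) hl' (hw i j ▸ hjr) (hw i j ▸ (h.symm.trans hj))
    rw [← hw] at e1 e2
    rw [e1, e2, List.map_append, List.map_append, List.prod_append, List.prod_append, hfb]

/-- The value of a map to a monoid on a reduced expression of a group element. -/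
noncomputable def reducedLift (f : B → N) (w : W) : N :=
  ((cs.exists_isReduced w).choose.map f).prod

/-- The right action of a generator on pairs consisting of an element of a monoid and a group
element, moving to the left the part of the group element that obstructs reducedness. -/
noncomputable def normalStep (f : B → N) (x : N × W) (i : B) : N × W :=
  (x.1 * cs.reducedLift f (x.2 * ((cs.exists_isMaxSuffix_simple i x.2).choose)⁻¹),
    (cs.exists_isMaxSuffix_simple i x.2).choose * cs.simple i)

theorem exists_normalStep_eq (f : B → N) (x : N × W) (i : B) :
    ∃ v, cs.IsMaxSuffix (cs.simple i) x.2 v ∧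
      cs.normalStep f x i = (x.1 * cs.reducedLift f (x.2 * v⁻¹), v * cs.simple i) :=
  ⟨_, (cs.exists_isMaxSuffix_simple i x.2).choose_spec, rfl⟩

variable {cs} {f : B → N}

theorem reducedLift_wordProd (hf : RespectsBraids M f) {l : List B} (hl : cs.IsReduced l) :
    cs.reducedLift f (cs.wordProd l) = (l.map f).prod := by
  have h := (cs.exists_isReduced (cs.wordProd l)).choose_spec
  exact cs.prod_map_eq_of_isReduced hf h.1 hl h.2.symm

theorem reducedLift_mul (hf : RespectsBraids M f) {u v : W}
    (h : cs.length (u * v) = cs.length u + cs.length v) :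
    cs.reducedLift f (u * v) = cs.reducedLift f u * cs.reducedLift f v := by
  obtain ⟨a, ha, rfl⟩ := cs.exists_isReduced u
  obtain ⟨b, hb, rfl⟩ := cs.exists_isReduced v
  rw [← wordProd_append] at h
  have hab : cs.IsReduced (a ++ b) := by
    rw [IsReduced, h, ha.eq, hb.eq, List.length_append]
  rw [← wordProd_append, reducedLift_wordProd hf hab, reducedLift_wordProd hf ha,
    reducedLift_wordProd hf hb, List.map_append, List.prod_append]

theorem reducedLift_one (hf : RespectsBraids M f) : cs.reducedLift f 1 = 1 := by
  simpa using reducedLift_wordProd hf (cs := cs) (l := []) (by simp [IsReduced])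

theorem reducedLift_simple (hf : RespectsBraids M f) (i : B) :
    cs.reducedLift f (cs.simple i) = f i := by
  simpa using reducedLift_wordProd hf (cs := cs) (l := [i]) (by simp [IsReduced])

theorem IsSuffix.reducedLift_mul_inv_mul (hf : RespectsBraids M f) {v w : W} (h : cs.IsSuffix v w) :
    cs.reducedLift f (w * v⁻¹) * cs.reducedLift f v = cs.reducedLift f w := by
  rw [← reducedLift_mul hf, inv_mul_cancel_right]
  rw [inv_mul_cancel_right]
  exact h.symm

theorem IsMaxSuffix.reducedLift_mul_simple (hf : RespectsBraids M f) {w v : W} {i : B}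
    (h : cs.IsMaxSuffix (cs.simple i) w v) :
    cs.reducedLift f (v * cs.simple i) = cs.reducedLift f v * f i := by
  rw [reducedLift_mul hf h.2.1, reducedLift_simple hf]

theorem normalStep_fst_mul_reducedLift_snd (hf : RespectsBraids M f) (x : N × W) (i : B) :
    (cs.normalStep f x i).1 * cs.reducedLift f (cs.normalStep f x i).2 =
      x.1 * cs.reducedLift f x.2 * f i := by
  obtain ⟨v, hv, h⟩ := cs.exists_normalStep_eq f x i
  rw [h, hv.reducedLift_mul_simple hf, ← hv.1.reducedLift_mul_inv_mul hf]
  simp only [mul_assoc]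

theorem mul_reducedLift_eq_of_normalStep_eq (hf : RespectsBraids M f) {x y : N × W} {i : B}
    (h : cs.normalStep f x i = cs.normalStep f y i) :
    x.1 * cs.reducedLift f x.2 = y.1 * cs.reducedLift f y.2 := by
  obtain ⟨v, hv, hx⟩ := cs.exists_normalStep_eq f x i
  obtain ⟨u, hu, hy⟩ := cs.exists_normalStep_eq f y i
  rw [hx, hy, Prod.mk.injEq] at h
  obtain ⟨h1, h2⟩ := h
  have huv := mul_right_cancel h2
  subst huv
  rw [← hv.1.reducedLift_mul_inv_mul hf, ← hu.1.reducedLift_mul_inv_mul hf, ← mul_assoc,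
    ← mul_assoc, h1]

theorem exists_foldl_normalStep_eq (hf : RespectsBraids M f) {l : List B}
    (hl : cs.IsReduced l) (x : N × W) :
    ∃ v, cs.IsMaxSuffix (cs.wordProd l) x.2 v ∧
      l.foldl (cs.normalStep f) x =
        (x.1 * cs.reducedLift f (x.2 * v⁻¹), v * cs.wordProd l) := by
  induction l using List.reverseRecOn with
  | nil =>
    refine ⟨x.2, ⟨isSuffix_refl _, by simp, fun v' hv' _ => hv'⟩, ?_⟩
    simp [reducedLift_one hf]
  | append_singleton l i ih =>
    have hl' : cs.IsReduced l := by simpa using hl.take l.length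
    obtain ⟨v, hv, h⟩ := ih hl'
    obtain ⟨u, hu, hi⟩ := cs.exists_normalStep_eq f (l.foldl (cs.normalStep f) x) i
    rw [h] at hu
    have hg : cs.length (cs.wordProd l * cs.simple i) = cs.length (cs.wordProd l) + 1 := by
      rw [hl'.eq, ← wordProd_singleton, ← wordProd_append, hl.eq]
      simp
    obtain ⟨h1, h2⟩ := hv.mul_simple hg hu
    refine ⟨u * (cs.wordProd l)⁻¹, by rwa [wordProd_append, wordProd_singleton], ?_⟩
    have h3 := h2.length_eq_add hv.1
    have h4 : x.2 * (u * (cs.wordProd l)⁻¹)⁻¹ =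
        (x.2 * v⁻¹) * (v * (u * (cs.wordProd l)⁻¹)⁻¹) := by group
    rw [h4] at h3
    rw [List.foldl_append, List.foldl_cons, List.foldl_nil, hi, h, h4, reducedLift_mul hf h3,
      wordProd_append, wordProd_singleton]
    simp only [mul_inv_rev, inv_inv, mul_assoc, inv_mul_cancel_left]

theorem foldl_normalStep_eq_of_isReduced (hf : RespectsBraids M f) {l l' : List B}
    (hl : cs.IsReduced l) (hl' : cs.IsReduced l') (h : cs.wordProd l = cs.wordProd l') (x : N × W) :
    l.foldl (cs.normalStep f) x = l'.foldl (cs.normalStep f) x := by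
  obtain ⟨v, hv, e⟩ := exists_foldl_normalStep_eq hf hl x
  obtain ⟨v', hv', e'⟩ := exists_foldl_normalStep_eq hf hl' x
  rw [h] at hv e
  rw [e, e', hv.unique hv']

end Lift

end CoxeterSystem

/-! ### Artin monoids -/

namespace CoxeterMat

/-- The Coxeter matrix with natural number entries, `0` standing for the absence of a relation. -/
def toCoxeterMatrix (M : CoxeterMat S) : CoxeterMatrix S where
  M := Matrix.of fun s t => (M.m s t).toNat
  isSymm := by
    ext s t
    simp [M.symm s t]
  diagonal s := by simp [M.diag]
  off_diagonal s t hst h := by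
    have h2 := M.two_le s t hst
    simp only [Matrix.of_apply] at h
    cases hm : M.m s t with
    | top => simp [hm] at h
    | coe k =>
      rw [hm] at h h2
      simp only [ENat.toNat_natCast] at h
      subst h
      exact absurd h2 (by decide)

theorem toCoxeterMatrix_apply (M : CoxeterMat S) (s t : S) :
    M.toCoxeterMatrix s t = (M.m s t).toNat := rfl

theorem m_eq_of_toCoxeterMatrix_ne_zero (M : CoxeterMat S) {s t : S}
    (h : M.toCoxeterMatrix s t ≠ 0) : M.m s t = (M.toCoxeterMatrix s t : ℕ∞) := by
  rw [toCoxeterMatrix_apply] at h ⊢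
  refine (ENat.natCast_toNat fun hc => h ?_).symm
  simp [hc]

/-- The Coxeter system attached to a Coxeter matrix. -/
noncomputable abbrev coxeterSystem (M : CoxeterMat S) :
    CoxeterSystem M.toCoxeterMatrix M.toCoxeterMatrix.Group :=
  M.toCoxeterMatrix.toCoxeterSystem

end CoxeterMat

open CoxeterSystem in
theorem altWord_eq_alternatingWord (s t : S) (k : ℕ) :
    altWord s t k = if Even k then alternatingWord s t k else alternatingWord t s k := by
  induction k generalizing s t with
  | zero => simp [altWord, alternatingWord]
  | succ k ih =>
    rw [altWord, ih t s, alternatingWord_succ', alternatingWord_succ']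
    by_cases hk : Even k
    · simp [hk, Nat.even_add_one]
    · simp [hk, Nat.even_add_one]

namespace ArtinMonoid

open CoxeterSystem

variable (M : CoxeterMat S)

theorem mk_ofList (l : List S) :
    PresentedMonoid.mk (artinRel M) (FreeMonoid.ofList l) = (l.map (of M)).prod := by
  induction l with
  | nil => rfl
  | cons s l ih => rw [List.map_cons, List.prod_cons, ← ih]; rfl

theorem respectsBraids_of : RespectsBraids M.toCoxeterMatrix (of M) := by
  intro s t hst h
  have key : PresentedMonoid.mk (artinRel M)
      (FreeMonoid.ofList (altWord s t (M.toCoxeterMatrix s t))) =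
      PresentedMonoid.mk (artinRel M)
        (FreeMonoid.ofList (altWord t s (M.toCoxeterMatrix s t))) :=
    Quotient.sound (ConGen.Rel.of _ _
      ⟨s, t, _, hst, M.m_eq_of_toCoxeterMatrix_ne_zero h, rfl, rfl⟩)
  rw [mk_ofList, mk_ofList, altWord_eq_alternatingWord, altWord_eq_alternatingWord] at key
  rw [braidWord, braidWord, M.toCoxeterMatrix.symmetric t s]
  split_ifs at key with hk
  · exact key
  · exact key.symm

/-- The induction principle building elements by multiplying generators on the right. -/
theorem induction_mul_of {M : CoxeterMat S} {p : ArtinMonoid M → Prop} (one : p 1)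
    (mul_of : ∀ b s, p b → p (b * of M s)) (b : ArtinMonoid M) : p b := by
  obtain ⟨w, rfl⟩ := PresentedMonoid.surjective_mk b
  obtain ⟨l, rfl⟩ := FreeMonoid.ofList.surjective w
  rw [mk_ofList]
  induction l using List.reverseRecOn with
  | nil => exact one
  | append_singleton l s ih => simpa using mul_of _ s ih

theorem eq_one_or_exists_eq_mul_of {M : CoxeterMat S} (b : ArtinMonoid M) :
    b = 1 ∨ ∃ b' s, b = b' * of M s := by
  induction b using induction_mul_of with
  | one => exact Or.inl rfl
  | mul_of b s _ => exact Or.inr ⟨b, s, rfl⟩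

/-- The pairs on which the Artin monoid acts by `CoxeterSystem.normalStep`. -/
abbrev NormalForm : Type _ := ArtinMonoid M × M.toCoxeterMatrix.Group

/-- `CoxeterSystem.normalStep` as an element of the opposite of the monoid of self-maps. -/
noncomputable def stepEnd (s : S) : (Function.End (NormalForm M))ᵐᵒᵖ :=
  MulOpposite.op fun x => M.coxeterSystem.normalStep (of M) x s

/-- The right action of the Artin monoid on pairs by `CoxeterSystem.normalStep`. -/
noncomputable def normalAction : ArtinMonoid M →* (Function.End (NormalForm M))ᵐᵒᵖ :=
  PresentedMonoid.lift (rels := artinRel M) (stepEnd M) <| by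
  have lift_ofList : ∀ l : List S, FreeMonoid.lift (stepEnd M) (FreeMonoid.ofList l) =
      MulOpposite.op fun x => l.foldl (M.coxeterSystem.normalStep (of M)) x := by
    intro l
    induction l with
    | nil => rfl
    | cons s l ih => rw [FreeMonoid.ofList_cons, map_mul, ih]; rfl
  rintro _ _ ⟨s, t, k, hst, hk, rfl, rfl⟩
  rw [lift_ofList, lift_ofList]
  have hm : M.toCoxeterMatrix s t = k := by rw [M.toCoxeterMatrix_apply, hk, ENat.toNat_natCast]
  have hm' : M.toCoxeterMatrix t s = k := by rw [M.toCoxeterMatrix.symmetric, hm]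
  have h1 := M.coxeterSystem.isReduced_alternatingWord hst (Or.inr hm.ge)
  have h2 := M.coxeterSystem.isReduced_alternatingWord hst.symm (Or.inr hm'.ge)
  have h3 := M.coxeterSystem.wordProd_braidWord_eq s t
  rw [braidWord, braidWord, hm, hm'] at h3
  congr 1
  funext x
  rw [altWord_eq_alternatingWord, altWord_eq_alternatingWord]
  split_ifs
  · exact foldl_normalStep_eq_of_isReduced (respectsBraids_of M) h1 h2 h3 x
  · exact foldl_normalStep_eq_of_isReduced (respectsBraids_of M) h2 h1 h3.symm x

variable {M}

/-- The normal form of an element: a factorization whose right factor is the largest one that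
lifts an element of the Coxeter group. -/
noncomputable def normalForm (b : ArtinMonoid M) : NormalForm M :=
  (normalAction M b).unop (1, 1)

theorem normalForm_mul_of (b : ArtinMonoid M) (s : S) :
    normalForm (b * of M s) = M.coxeterSystem.normalStep (of M) (normalForm b) s := by
  have h : normalAction M (of M s) = stepEnd M s := rfl
  rw [normalForm, map_mul, h]
  rfl

theorem normalForm_fst_mul_reducedLift_snd (b : ArtinMonoid M) :
    (normalForm b).1 * M.coxeterSystem.reducedLift (of M) (normalForm b).2 = b := by
  induction b using induction_mul_of with
  | one =>
    rw [normalForm, map_one]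
    exact (one_mul _).trans (reducedLift_one (respectsBraids_of M))
  | mul_of b s ih =>
    rw [normalForm_mul_of, normalStep_fst_mul_reducedLift_snd (respectsBraids_of M), ih]

theorem mul_of_right_cancel {x y : ArtinMonoid M} {s : S} (h : x * of M s = y * of M s) :
    x = y := by
  have h1 := congrArg normalForm h
  rw [normalForm_mul_of, normalForm_mul_of] at h1
  have h2 := mul_reducedLift_eq_of_normalStep_eq (respectsBraids_of M) h1
  rwa [normalForm_fst_mul_reducedLift_snd, normalForm_fst_mul_reducedLift_snd] at h2

instance : IsRightCancelMul (ArtinMonoid M) where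
  mul_right_cancel b x y h := by
    induction b using induction_mul_of with
    | one => simpa using h
    | mul_of b s ih =>
      refine ih (mul_of_right_cancel (s := s) ?_)
      simpa only [mul_assoc] using h

theorem isRightDescent_normalForm_mul_of (b : ArtinMonoid M) (s : S) :
    M.coxeterSystem.IsRightDescent (normalForm (b * of M s)).2 s := by
  obtain ⟨v, hv, h⟩ := M.coxeterSystem.exists_normalStep_eq (of M) (normalForm b) s
  have h1 := hv.2.1
  rw [length_simple] at h1
  rw [normalForm_mul_of, h, IsRightDescent, simple_mul_simple_cancel_right, h1]
  exact Nat.lt_succ_self _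

/-- The alternating product of the generators `s` and `t` with `k` factors, ending with `t`. -/
def altProd (M : CoxeterMat S) (s t : S) (k : ℕ) : ArtinMonoid M :=
  ((alternatingWord s t k).map (of M)).prod

theorem altProd_succ (s t : S) (k : ℕ) :
    altProd M s t (k + 1) = altProd M t s k * of M t := by
  simp [altProd, alternatingWord_succ]

theorem exists_eq_mul_altProd {x y : ArtinMonoid M} {s t : S} (hst : s ≠ t)
    (h : x * of M s = y * of M t) :
    M.toCoxeterMatrix s t ≠ 0 ∧ ∃ z, x * of M s = z * altProd M s t (M.toCoxeterMatrix s t) := by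
  have hs := isRightDescent_normalForm_mul_of x s
  have ht := isRightDescent_normalForm_mul_of y t
  rw [← h] at ht
  obtain ⟨h0, g, hg, hl⟩ := M.coxeterSystem.exists_eq_mul_braidWord hst hs ht
  have hred := M.coxeterSystem.isReduced_alternatingWord hst (Or.inr le_rfl)
  refine ⟨h0, (normalForm (x * of M s)).1 * M.coxeterSystem.reducedLift (of M) g, ?_⟩
  conv_lhs => rw [← normalForm_fst_mul_reducedLift_snd (x * of M s), hg]
  rw [reducedLift_mul (respectsBraids_of M), reducedLift_wordProd (respectsBraids_of M) hred,
    mul_assoc, altProd]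
  rw [← hg, hl, hred.eq, length_alternatingWord]

/-- Two distinct generators with a common left multiple have a least one. -/
theorem exists_lcm_of {M : CoxeterMat S} {x y : ArtinMonoid M} {s t : S} (hst : s ≠ t)
    (h : x * of M s = y * of M t) :
    ∃ p q : ArtinMonoid M, p * of M s = q * of M t ∧
      ∀ x' y' : ArtinMonoid M, x' * of M s = y' * of M t → ∃ z, x' = z * p ∧ y' = z * q := by
  obtain ⟨h0, -⟩ := exists_eq_mul_altProd hst h
  obtain ⟨m, hm⟩ := Nat.exists_eq_succ_of_ne_zero h0
  have hb := respectsBraids_of M s t hst h0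
  rw [braidWord, braidWord, M.toCoxeterMatrix.symmetric t s, hm] at hb
  change altProd M s t (m + 1) = altProd M t s (m + 1) at hb
  rw [altProd_succ, altProd_succ] at hb
  refine ⟨_, _, hb.symm, fun x' y' h' => ?_⟩
  obtain ⟨-, z, hz⟩ := exists_eq_mul_altProd hst h'
  rw [hm, Nat.succ_eq_add_one, altProd_succ, ← mul_assoc] at hz
  refine ⟨z, mul_right_cancel (b := of M s) ?_, mul_right_cancel (b := of M t) (h'.symm.trans hz)⟩
  rw [hz, mul_assoc, hb, ← mul_assoc]

/-- The word length of an element. -/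
def len (M : CoxeterMat S) : ArtinMonoid M →* Multiplicative ℕ :=
  PresentedMonoid.lift (rels := artinRel M) (fun _ => Multiplicative.ofAdd 1) <| by
  have lift_ofList : ∀ l : List S,
      FreeMonoid.lift (fun _ => Multiplicative.ofAdd 1) (FreeMonoid.ofList l) =
        Multiplicative.ofAdd l.length := by
    intro l
    induction l with
    | nil => rfl
    | cons s l ih =>
      rw [FreeMonoid.ofList_cons, map_mul, ih, FreeMonoid.lift_eval_of, List.length_cons,
        add_comm]
      rfl
  have length_altWord : ∀ (k : ℕ) (s t : S), (altWord s t k).length = k := by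
    intro k
    induction k with
    | zero => simp [altWord]
    | succ k ih => simp [altWord, ih]
  rintro _ _ ⟨s, t, k, -, -, rfl, rfl⟩
  rw [lift_ofList, lift_ofList, length_altWord, length_altWord]

theorem toAdd_len_mul_of (b : ArtinMonoid M) (s : S) :
    (len M (b * of M s)).toAdd = (len M b).toAdd + 1 := by
  rw [map_mul]
  rfl

theorem toAdd_len_mul (a b : ArtinMonoid M) :
    (len M (a * b)).toAdd = (len M a).toAdd + (len M b).toAdd := by
  rw [map_mul]
  rfl

end ArtinMonoid

theorem isLeftLcm_mul_right {N : Type*} [Monoid N] [IsRightCancelMul N] {a b l : N}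
    (h : IsLeftLcm a b l) (g : N) : IsLeftLcm (a * g) (b * g) (l * g) := by
  obtain ⟨⟨x, rfl⟩, ⟨y, hy⟩, hl⟩ := h
  refine ⟨⟨x, mul_assoc _ _ _⟩, ⟨y, by rw [hy, mul_assoc]⟩, ?_⟩
  rintro d ⟨x', rfl⟩ ⟨y', h'⟩
  rw [← mul_assoc, ← mul_assoc] at h'
  obtain ⟨e, he⟩ := hl (x' * a) ⟨x', rfl⟩ ⟨y', mul_right_cancel h'⟩
  exact ⟨e, by rw [← mul_assoc, he, mul_assoc]⟩

/-- Two elements of an Artin monoid admitting a common left multiple admit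
a left least common multiple. -/
theorem artinMonoid_leftLcm_of_commonLeftMultiple {S : Type*} (M : CoxeterMat S)
    (a b c u v : ArtinMonoid M) (hu : c = u * a) (hv : c = v * b) :
    ∃ ℓ : ArtinMonoid M, IsLeftLcm a b ℓ := by
  induction hn : (ArtinMonoid.len M c).toAdd using Nat.strong_induction_on
    generalizing a b c u v with
  | _ n ih =>
    rcases ArtinMonoid.eq_one_or_exists_eq_mul_of a with rfl | ⟨a, s, rfl⟩
    · exact ⟨b, ⟨b, (mul_one b).symm⟩, ⟨1, (one_mul b).symm⟩, fun d _ hd => hd⟩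
    rcases ArtinMonoid.eq_one_or_exists_eq_mul_of b with rfl | ⟨b, t, rfl⟩
    · exact ⟨_, ⟨1, (one_mul _).symm⟩, ⟨_, (mul_one _).symm⟩, fun d hd _ => hd⟩
    rw [← mul_assoc] at hu hv
    have hlu : (ArtinMonoid.len M (u * a)).toAdd < n := by
      rw [← hn, hu, ArtinMonoid.toAdd_len_mul_of]
      omega
    have hlv : (ArtinMonoid.len M (v * b)).toAdd < n := by
      rw [← hn, hv, ArtinMonoid.toAdd_len_mul_of]
      omega
    have huv := hu.symm.trans hv
    by_cases hst : s = t
    · subst hst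
      obtain ⟨l, hl⟩ := ih _ hlu a b _ u v rfl (mul_right_cancel huv) rfl
      exact ⟨_, isLeftLcm_mul_right hl _⟩
    obtain ⟨p, q, hpq, hmin⟩ := ArtinMonoid.exists_lcm_of hst huv
    obtain ⟨z, hzp, hzq⟩ := hmin _ _ huv
    obtain ⟨l₁, hl₁⟩ := ih _ hlu a p _ u z rfl hzp rfl
    obtain ⟨l₂, hl₂⟩ := ih _ hlv b q _ v z rfl hzq rfl
    obtain ⟨k₁, hk₁⟩ := hl₁.2.2 (u * a) ⟨u, rfl⟩ ⟨z, hzp⟩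
    obtain ⟨k₂, hk₂⟩ := hl₂.2.2 (v * b) ⟨v, rfl⟩ ⟨z, hzq⟩
    have hm₁ := isLeftLcm_mul_right hl₁ (ArtinMonoid.of M s)
    have hm₂ := isLeftLcm_mul_right hl₂ (ArtinMonoid.of M t)
    obtain ⟨y₁, hy₁⟩ := hm₁.2.1
    obtain ⟨y₂, hy₂⟩ := hm₂.2.1
    rw [hy₁] at hm₁
    rw [hy₂, ← hpq] at hm₂
    have hz₁ : z = k₁ * y₁ := by
      apply mul_right_cancel (b := p * ArtinMonoid.of M s)
      rw [← mul_assoc, ← hzp, hk₁, mul_assoc, hy₁, mul_assoc]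
    have hz₂ : z = k₂ * y₂ := by
      apply mul_right_cancel (b := p * ArtinMonoid.of M s)
      rw [← mul_assoc, ← hzp, huv, hk₂, mul_assoc, hy₂, hpq, mul_assoc]
    have hlz : (ArtinMonoid.len M z).toAdd < n := by
      rw [hzp, ArtinMonoid.toAdd_len_mul] at hlu
      omega
    obtain ⟨l, ⟨x₁, hx₁⟩, ⟨x₂, hx₂⟩, hl⟩ := ih _ hlz y₁ y₂ z k₁ k₂ hz₁ hz₂ rfl
    obtain ⟨⟨e₁, he₁⟩, -, hm₁⟩ := hm₁
    obtain ⟨⟨e₂, he₂⟩, -, hm₂⟩ := hm₂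
    refine ⟨l * (p * ArtinMonoid.of M s), ⟨x₁ * e₁, ?_⟩, ⟨x₂ * e₂, ?_⟩, ?_⟩
    · rw [hx₁, mul_assoc, he₁, mul_assoc]
    · rw [hx₂, mul_assoc, he₂, mul_assoc]
    rintro d ⟨x, hx⟩ ⟨y, hy⟩
    have hxy : x * a * ArtinMonoid.of M s = y * b * ArtinMonoid.of M t := by
      rw [mul_assoc, ← hx, hy, mul_assoc]
    obtain ⟨w, hw, -⟩ := hmin _ _ hxy
    have hd : d = w * (p * ArtinMonoid.of M s) := by rw [hx, ← mul_assoc, hw, mul_assoc]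
    obtain ⟨f₁, hf₁⟩ := hm₁ d ⟨x, hx⟩ ⟨w, hd⟩
    obtain ⟨f₂, hf₂⟩ := hm₂ d ⟨y, hy⟩ ⟨w, by rw [hd, hpq]⟩
    have hw₁ : w = f₁ * y₁ := by
      apply mul_right_cancel (b := p * ArtinMonoid.of M s)
      rw [← hd, hf₁, mul_assoc]
    have hw₂ : w = f₂ * y₂ := by
      apply mul_right_cancel (b := p * ArtinMonoid.of M s)
      rw [← hd, hf₂, mul_assoc]
    obtain ⟨e, he⟩ := hl w ⟨f₁, hw₁⟩ ⟨f₂, hw₂⟩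
    exact ⟨e, by rw [hd, he, mul_assoc]⟩
end

section
/- Let C be a small category. The nerve N(C) has Property A (i.e. every face of a non-degenerate simplex of N(C) is again non-degenerate) if and only if the following holds: whenever f : A → B and g : B → A are morphisms in C with g ∘ f = id_A, then A = B and f = g = id. -/
open CategoryTheory Opposite

/-- An `n`-simplex of a simplicial set is degenerate if it lies in the image of one of the
degeneracy maps. -/
def SSet.IsDegenerate (X : SSet) : ∀ {n : ℕ}, X.obj (op (SimplexCategory.mk n)) → Prop
  | 0, _ => False
  | n + 1, x => ∃ i : Fin (n + 1), x ∈ Set.range (X.map (SimplexCategory.σ i).op)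

/-- A simplicial set has Property A if every face of every non-degenerate simplex is again
non-degenerate. -/
def SSet.PropertyA (X : SSet) : Prop :=
  ∀ (n : ℕ) (x : X.obj (op (SimplexCategory.mk (n + 1)))), ¬ X.IsDegenerate x →
    ∀ i : Fin (n + 2), ¬ X.IsDegenerate (X.map (SimplexCategory.δ i).op x)

namespace CategoryTheory

variable {C : Type*} [Category* C]

/-- A morphism `f : A ⟶ B` is an identity if `A = B` and `f` is the resulting morphism. -/
def IsEqToHom {A B : C} (f : A ⟶ B) : Prop :=
  ∃ h : A = B, f = eqToHom h

/-- A functor out of a preorder is unchanged by precomposition with a monotone map `φ ≤ id`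
if it sends all the inequalities `φ j ≤ j` to identities. -/
lemma Functor.comp_eq_self_of_isEqToHom {J : Type*} [Preorder J] (x : J ⥤ C) (φ : J ⥤ J)
    (le : ∀ j, φ.obj j ≤ j) (h : ∀ j, IsEqToHom (x.map (homOfLE (le j)))) : φ ⋙ x = x := by
  choose e he using h
  refine Functor.ext e fun j k f ↦ ?_
  have : x.map (φ.map f) ≫ x.map (homOfLE (le k)) = x.map (homOfLE (le j)) ≫ x.map f := by
    simp only [← x.map_comp]
    rfl
  rw [he, he] at this
  rw [← Category.assoc, ← this]
  simp

end CategoryTheory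

namespace CategoryTheory.nerve

variable {C : Type*} [Category* C] {n : ℕ}

/-- The functor between linear orders underlying `σ i` followed by `δ i.succ`. -/
def collapse (i : Fin (n + 1)) : Fin (n + 2) ⥤ Fin (n + 2) :=
  (SimplexCategory.toCat.map (SimplexCategory.σ i ≫ SimplexCategory.δ i.succ)).toFunctor

lemma collapse_obj (i : Fin (n + 1)) (j : Fin (n + 2)) :
    (collapse i).obj j = i.succ.succAbove (i.predAbove j) := rfl

lemma collapse_obj_succ (i : Fin (n + 1)) : (collapse i).obj i.succ = i.castSucc := by
  simp [collapse_obj]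

lemma collapse_obj_of_ne (i : Fin (n + 1)) {j : Fin (n + 2)} (hj : j ≠ i.succ) :
    (collapse i).obj j = j := by
  rw [collapse_obj]
  exact Fin.succ_succAbove_predAbove hj

lemma collapse_obj_le (i : Fin (n + 1)) (j : Fin (n + 2)) : (collapse i).obj j ≤ j := by
  by_cases hj : j = i.succ
  · subst hj
    rw [collapse_obj_succ]
    exact Fin.castSucc_lt_succ.le
  · exact (collapse_obj_of_ne i hj).le

lemma isEqToHom_map_of_eq {J : Type*} [Preorder J] (x : J ⥤ C) {a b : J} (f : a ⟶ b)
    (h : a = b) : IsEqToHom (x.map f) := by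
  subst h
  exact ⟨rfl, x.map_id a⟩

lemma mem_range_σ_iff (x : ComposableArrows C (n + 1)) (i : Fin (n + 1)) :
    x ∈ Set.range ((nerve C).map (SimplexCategory.σ i).op) ↔
      IsEqToHom (x.map (homOfLE (Fin.castSucc_lt_succ (i := i)).le)) := by
  constructor
  · rintro ⟨y, rfl⟩
    exact isEqToHom_map_of_eq (J := Fin (n + 1)) y _
      (show i.predAbove i.castSucc = i.predAbove i.succ by simp)
  · intro h
    refine ⟨(nerve C).map (SimplexCategory.δ i.succ).op x,
      Functor.comp_eq_self_of_isEqToHom x (collapse i) (collapse_obj_le i) fun j ↦ ?_⟩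
    by_cases hj : j = i.succ
    · subst hj
      convert h <;> exact collapse_obj_succ i
    · exact isEqToHom_map_of_eq x _ (collapse_obj_of_ne i hj)

lemma isDegenerate_iff {D : Type} [SmallCategory D] (x : ComposableArrows D (n + 1)) :
    (nerve D).IsDegenerate (n := n + 1) x ↔
      ∃ i : Fin (n + 1), IsEqToHom (x.map (homOfLE (Fin.castSucc_lt_succ (i := i)).le)) :=
  exists_congr (mem_range_σ_iff x)

end CategoryTheory.nerve

/-- May. The nerve of a small category `C` has Property A if and only if
whenever `g ∘ f = id`, both `f` and `g` are identities. -/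
theorem nerve_propertyA_iff_no_nontrivial_retractions (C : Type) [SmallCategory C] :
    SSet.PropertyA (nerve C) ↔
      ∀ (A B : C) (f : A ⟶ B) (g : B ⟶ A), f ≫ g = 𝟙 A →
        ∃ h : A = B, f = eqToHom h ∧ g = eqToHom h.symm := by
  constructor
  · intro hA A B f g hfg
    have hdeg : (nerve C).IsDegenerate (n := 2) (ComposableArrows.mk₂ f g) := by
      by_contra hx
      refine hA 1 _ hx 1 ((nerve.isDegenerate_iff (n := 0) _).2 ⟨0, rfl, ?_⟩)
      exact hfg
    obtain ⟨i, hi⟩ := (nerve.isDegenerate_iff (n := 1) _).1 hdeg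
    fin_cases i
    · obtain ⟨h, hf⟩ : IsEqToHom f := hi
      subst h
      simp_all
    · obtain ⟨h, hg⟩ : IsEqToHom g := hi
      subst h
      simp_all
  · intro hC n x hx i hd
    refine hx ((nerve.isDegenerate_iff x).2 ?_)
    cases n with
    | zero => exact hd.elim
    | succ m =>
      obtain ⟨j, hj⟩ := (nerve.isDegenerate_iff _).1 hd
      let F : Fin (m + 3) ⥤ C := x
      have hlt : i.succAbove j.castSucc < i.succAbove j.succ :=
        (Fin.strictMono_succAbove i) Fin.castSucc_lt_succ
      obtain ⟨h, hid⟩ : IsEqToHom (F.map (homOfLE hlt.le)) := hj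
      generalize i.succAbove j.castSucc = a, i.succAbove j.succ = b at hlt h hid
      obtain ⟨k, rfl⟩ := Fin.exists_castSucc_eq.2 (Fin.ne_last_of_lt hlt)
      have hkb : k.succ ≤ b := Fin.castSucc_lt_iff_succ_le.1 hlt
      obtain ⟨h', hf, -⟩ := hC _ _ (F.map (homOfLE (Fin.castSucc_lt_succ (i := k)).le))
        (F.map (homOfLE hkb) ≫ eqToHom h.symm) (by
          rw [← Category.assoc, ← F.map_comp]
          exact (congrArg (· ≫ eqToHom h.symm) hid).trans (by simp))
      exact ⟨k, h', hf⟩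
end
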